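/- arXiv:1507.06141 — 3 statements merged into one kernel-verified Lean document; each statement's English description precedes it below -/
import Mathlib

section
/- For every simple signed graph G, fix(G) ≤ (3/2)^{m'(G)} · mis(G), where m'(G) is the maximum size of a matching M such that every edge uv of M is contained in an induced 4-cycle in which u and v are the only vertices adjacent to an edge of M. -/
/-- `S` is a fixed set of the conjunctive network with positive edges `pos`,
negative edges `neg`. -/
def IsFixedSet {V : Type*} (pos neg : V → V → Prop) (S : Set V) : Prop :=
  ∀ v, v ∈ S ↔ (∀ u, pos u v → u ∈ S) ∧ (∀ u, neg u v → u ∉ S)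

/-- Number of fixed points of the conjunctive network. -/
noncomputable def fixc {V : Type*} (pos neg : V → V → Prop) : ℕ :=
  Set.ncard {S : Set V | IsFixedSet pos neg S}

/-- `S` is a maximal independent set of the graph with adjacency `adj`. -/
def IsMaxIndep {V : Type*} (adj : V → V → Prop) (S : Set V) : Prop :=
  (∀ u ∈ S, ∀ v ∈ S, ¬ adj u v) ∧ ∀ v, v ∉ S → ∃ u ∈ S, adj u v

/-- Number of maximal independent sets. -/
noncomputable def misc {V : Type*} (adj : V → V → Prop) : ℕ :=
  Set.ncard {S : Set V | IsMaxIndep adj S}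

/-- `{a,b,u,v}` induces a 4-cycle `a-b-u-v-a`. -/
def IsInducedC4 {V : Type*} (adj : V → V → Prop) (a b u v : V) : Prop :=
  a ≠ b ∧ a ≠ u ∧ a ≠ v ∧ b ≠ u ∧ b ≠ v ∧ u ≠ v ∧
  adj a b ∧ adj b u ∧ adj u v ∧ adj v a ∧ ¬ adj a u ∧ ¬ adj b v

/-- `M` (a finite set of ordered pairs, one per edge) is a matching of the graph with
adjacency `adj` such that every edge `uv ∈ M` lies in an induced 4-cycle in which `u`
and `v` are the only vertices that are endpoints of an edge of `M`. -/
def GoodMatchingM' {V : Type*} (adj : V → V → Prop) (M : Finset (V × V)) : Prop :=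
  (∀ p ∈ M, adj p.1 p.2) ∧
  (∀ p ∈ M, ∀ q ∈ M, p ≠ q → p.1 ≠ q.1 ∧ p.1 ≠ q.2 ∧ p.2 ≠ q.1 ∧ p.2 ≠ q.2) ∧
  (∀ p ∈ M, ∃ w x, IsInducedC4 adj p.1 p.2 w x ∧
    ∀ q ∈ M, w ≠ q.1 ∧ w ≠ q.2 ∧ x ≠ q.1 ∧ x ≠ q.2)

namespace Conj
open Classical

variable {V : Type*}

/-- Fixed sets when the positive edges are `P`. -/
def F (adj P : V → V → Prop) : Set (Set V) :=
  {S | IsFixedSet P (fun x y => adj x y ∧ ¬ P x y) S}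

/-- Turn all the edges at `c` negative. -/
def del (P : V → V → Prop) (c : V) : V → V → Prop := fun x y => P x y ∧ x ≠ c ∧ y ≠ c

/-- vertices freed by removing `c` -/
def U (adj P : V → V → Prop) (S : Set V) (c : V) : Set V :=
  {x | (∀ y, ¬ P x y) ∧ x ∉ S ∧ ∀ y ∈ S, y ≠ c → ¬ adj x y}

/-- new singletons -/
def NS (P : V → V → Prop) (c : V) : Set V :=
  {x | (∃ y, P x y) ∧ ∀ y, ¬ del P c x y}

lemma exMax [Finite V] (adj : V → V → Prop) (hs : ∀ x y, adj x y → adj y x)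
    (W X0 : Set V) (h0 : X0 ⊆ W) (hi : ∀ x ∈ X0, ∀ y ∈ X0, ¬ adj x y)
    (hirr : ∀ x, ¬ adj x x) :
    ∃ X, X0 ⊆ X ∧ X ⊆ W ∧ (∀ x ∈ X, ∀ y ∈ X, ¬ adj x y) ∧ ∀ v ∈ W, v ∉ X → ∃ u ∈ X, adj u v := by
  obtain ⟨X, hX⟩ := Set.Finite.exists_maximal
    (s := {X : Set V | X0 ⊆ X ∧ X ⊆ W ∧ ∀ x ∈ X, ∀ y ∈ X, ¬ adj x y}) (Set.toFinite _)
    ⟨X0, subset_rfl, h0, hi⟩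
  refine ⟨X, hX.1.1, hX.1.2.1, hX.1.2.2, ?_⟩
  intro v hv hvX
  by_contra hcon
  push Not at hcon
  have hmem : insert v X ∈ {X : Set V | X0 ⊆ X ∧ X ⊆ W ∧ ∀ x ∈ X, ∀ y ∈ X, ¬ adj x y} := by
    refine ⟨hX.1.1.trans (Set.subset_insert _ _), Set.insert_subset hv hX.1.2.1, ?_⟩
    rintro x (rfl | hx) y (rfl | hy)
    · exact hirr _
    · exact fun h => hcon y hy (hs _ _ h)
    · exact hcon x hx
    · exact hX.1.2.2 x hx y hy
  exact hvX (hX.2 hmem (Set.subset_insert _ _) (Set.mem_insert _ _))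

/-- standing hypotheses -/
structure Ok (adj P : V → V → Prop) : Prop where
  as : ∀ x y, adj x y → adj y x
  ai : ∀ x, ¬ adj x x
  ps : ∀ x y, P x y → P y x
  le : ∀ x y, P x y → adj x y

variable {adj P : V → V → Prop}

lemma Ok.del (h : Ok adj P) (c : V) : Ok adj (del P c) :=
  ⟨h.as, h.ai, fun x y hx => ⟨h.ps _ _ hx.1, hx.2.2, hx.2.1⟩, fun x y hx => h.le _ _ hx.1⟩

lemma F_pos {S : Set V} (hS : S ∈ F adj P) {x y : V} (h : P x y) (hy : y ∈ S) : x ∈ S :=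
  ((hS y).1 hy).1 x h

lemma F_neg {S : Set V} (hS : S ∈ F adj P) {x y : V} (h : adj x y) (hx : x ∈ S) (hy : y ∈ S) :
    P x y := by
  by_contra hP
  exact ((hS y).1 hy).2 x ⟨h, hP⟩ hx

lemma F_out {S : Set V} (hS : S ∈ F adj P) {v : V} (hv : v ∉ S) :
    (∃ u, P u v ∧ u ∉ S) ∨ ∃ u, adj u v ∧ ¬ P u v ∧ u ∈ S := by
  by_contra hcon
  push Not at hcon
  exact hv ((hS v).2 ⟨hcon.1, fun u hu => hcon.2 u hu.1 hu.2⟩)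

lemma F_mk {S : Set V} (h1 : ∀ x y, P x y → y ∈ S → x ∈ S)
    (h2 : ∀ x y, adj x y → x ∈ S → y ∈ S → P x y)
    (h3 : ∀ v, v ∉ S → (∃ u, P u v ∧ u ∉ S) ∨ ∃ u, adj u v ∧ ¬ P u v ∧ u ∈ S) : S ∈ F adj P := by
  intro v
  constructor
  · intro hv
    exact ⟨fun u hu => h1 u v hu hv, fun u hu hx => hu.2 (h2 u v hu.1 hx hv)⟩
  · rintro ⟨ha, hb⟩
    by_contra hv
    rcases h3 v hv with ⟨u, hu, hn⟩ | ⟨u, hu, hn, hm⟩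
    · exact hn (ha u hu)
    · exact hb u ⟨hu, hn⟩ hm

lemma U_adj (h : Ok adj P) {S : Set V} (hS : S ∈ F adj P) {c x : V} (hx : x ∈ U adj P S c) :
    adj c x := by
  obtain ⟨h1, h2, h3⟩ := hx
  rcases F_out hS h2 with ⟨u, hu, _⟩ | ⟨u, hu, _, hm⟩
  · exact absurd (h.ps _ _ hu) (h1 u)
  · by_cases hc : u = c
    · exact hc ▸ hu
    · exact absurd (h.as _ _ hu) (h3 u hm hc)

lemma exf [Finite V] (h : Ok adj P) {S : Set V} (hS : S ∈ F adj P) {c d : V} (hc : c ∈ S)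
    (hd : P c d) :
    ∃ T ∈ F adj (del P c), (∀ x ∈ S, x ≠ c → x ∈ T) ∧ c ∉ T ∧
      ∀ x ∈ T, (x ∈ S ∧ x ≠ c) ∨ x ∈ U adj P S c := by
  obtain ⟨X, -, hXU, hXi, hXm⟩ := exMax adj h.as (U adj P S c) ∅ (Set.empty_subset _)
    (by simp) h.ai
  have hdS : d ∈ S := F_pos hS (h.ps _ _ hd) hc
  have hdc : d ≠ c := by rintro rfl; exact h.ai _ (h.le _ _ hd)
  have hcX : c ∉ X := fun hx => (hXU hx).2.1 hc
  refine ⟨{x | (x ∈ S ∧ x ≠ c) ∨ x ∈ X}, ?_, fun x hx hxc => Or.inl ⟨hx, hxc⟩, ?_, ?_⟩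
  · apply F_mk
    · rintro x y ⟨hp, hxc, hyc⟩ (⟨hy, -⟩ | hy)
      · exact Or.inl ⟨F_pos hS hp hy, hxc⟩
      · exact absurd (h.ps _ _ hp) ((hXU hy).1 x)
    · rintro x y ha (⟨hx, hxc⟩ | hx) (⟨hy, hyc⟩ | hy)
      · exact ⟨F_neg hS ha hx hy, hxc, hyc⟩
      · exact absurd (h.as _ _ ha) ((hXU hy).2.2 x hx hxc)
      · exact absurd ha ((hXU hx).2.2 y hy hyc)
      · exact absurd ha (hXi x hx y hy)
    · intro v hv
      simp only [Set.mem_ofPred_eq, not_or, not_and, not_not] at hv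
      by_cases hvc : v = c
      · subst hvc
        exact Or.inr ⟨d, h.as _ _ (h.le _ _ hd), fun hh => hh.2.2 rfl, Or.inl ⟨hdS, hdc⟩⟩
      have hvS : v ∉ S := fun hh => hvc (hv.1 hh)
      by_cases hP : ∃ u, P v u
      · obtain ⟨u, hu⟩ := hP
        have huS : u ∉ S := fun hh => hvS (F_pos hS hu hh)
        refine Or.inl ⟨u, ⟨h.ps _ _ hu, ?_, hvc⟩, ?_⟩
        · rintro rfl; exact huS hc
        · rintro (hh | hh)
          · exact huS hh.1
          · exact (hXU hh).1 v (h.ps _ _ hu)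
      · push Not at hP
        by_cases hU : v ∈ U adj P S c
        · obtain ⟨u, hu, hua⟩ := hXm v hU hv.2
          exact Or.inr ⟨u, hua, fun hh => hP u (h.ps _ _ hh.1), Or.inr hu⟩
        · have : ∃ y ∈ S, y ≠ c ∧ adj v y := by
            by_contra hcon
            push Not at hcon
            exact hU ⟨hP, hvS, hcon⟩
          obtain ⟨y, hy, hyc, hya⟩ := this
          exact Or.inr ⟨y, h.as _ _ hya, fun hh => hP y (h.ps _ _ hh.1), Or.inl ⟨hy, hyc⟩⟩
  · rintro (hh | hh)
    · exact hh.2 rfl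
    · exact hcX hh
  · rintro x (hx | hx)
    · exact Or.inl hx
    · exact Or.inr (hXU hx)

lemma exg [Finite V] (h : Ok adj P) {S : Set V} (hS : S ∈ F adj P) {c d : V} (hc : c ∉ S)
    (hd : P c d) :
    ∃ T ∈ F adj (del P c), (∀ x, x ∈ S ↔ x ∈ T ∧ x ∉ NS P c) ∧
      (c ∉ T → ∃ s ∈ S, adj c s) ∧ (∀ x ∈ T, x ∉ S → ∀ s ∈ S, ¬ adj x s) := by
  have hcNS : c ∈ NS P c := ⟨⟨d, hd⟩, fun y hy => hy.2.1 rfl⟩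
  have hNS : ∀ x ∈ NS P c, x ∉ S := by
    rintro x ⟨⟨y, hy⟩, hn⟩ hx
    by_cases hxc : x = c
    · exact hc (hxc ▸ hx)
    · by_cases hyc : y = c
      · subst hyc
        exact hc (F_pos hS (h.ps _ _ hy) hx)
      · exact hn y ⟨hy, hxc, hyc⟩
  let W : Set V := {x | x ∈ NS P c ∧ ∀ s ∈ S, ¬ adj x s}
  obtain ⟨Z, hZ0, hZW, hZi, hZm⟩ := exMax adj h.as W {x | x = c ∧ c ∈ W}
    (by rintro x ⟨rfl, hx⟩; exact hx)
    (by rintro x ⟨rfl, hx⟩ y ⟨rfl, hy⟩; exact h.ai _) h.ai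
  refine ⟨{x | x ∈ S ∨ x ∈ Z}, ?_, ?_, ?_, ?_⟩
  · apply F_mk
    · rintro x y hp (hy | hy)
      · exact Or.inl (F_pos hS hp.1 hy)
      · exact absurd ((h.del c).ps _ _ hp) ((hZW hy).1.2 x)
    · rintro x y ha (hx | hx) (hy | hy)
      · exact ⟨F_neg hS ha hx hy, fun e => hc (e ▸ hx), fun e => hc (e ▸ hy)⟩
      · exact absurd (h.as _ _ ha) ((hZW hy).2 x hx)
      · exact absurd ha ((hZW hx).2 y hy)
      · exact absurd ha (hZi x hx y hy)
    · intro v hv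
      simp only [Set.mem_ofPred_eq, not_or] at hv
      obtain ⟨hvS, hvZ⟩ := hv
      by_cases hvN : v ∈ NS P c
      · by_cases hvW : v ∈ W
        · obtain ⟨u, hu, hua⟩ := hZm v hvW hvZ
          exact Or.inr ⟨u, hua, fun hh => hvN.2 u ((h.del c).ps _ _ hh), Or.inr hu⟩
        · have : ∃ s ∈ S, adj v s := by
            by_contra hcon
            push Not at hcon
            exact hvW ⟨hvN, hcon⟩
          obtain ⟨s, hs, hsa⟩ := this
          exact Or.inr ⟨s, h.as _ _ hsa, fun hh => hvN.2 s ((h.del c).ps _ _ hh), Or.inl hs⟩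
      · by_cases hP : ∃ y, del P c v y
        · obtain ⟨y, hy⟩ := hP
          refine Or.inl ⟨y, (h.del c).ps _ _ hy, ?_⟩
          rintro (hh | hh)
          · exact hvS (F_pos hS hy.1 hh)
          · exact (hZW hh).1.2 v ((h.del c).ps _ _ hy)
        · push Not at hP
          have hn : ∀ y, ¬ P v y := fun y hy => hvN ⟨⟨y, hy⟩, hP⟩
          rcases F_out hS hvS with ⟨u, hu, _⟩ | ⟨u, hu, hu2, hm⟩
          · exact absurd (h.ps _ _ hu) (hn u)
          · exact Or.inr ⟨u, hu, fun hh => hu2 hh.1, Or.inl hm⟩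
  · intro x
    constructor
    · intro hx
      exact ⟨Or.inl hx, fun hh => hNS x hh hx⟩
    · rintro ⟨hx | hx, hn⟩
      · exact hx
      · exact absurd (hZW hx).1 hn
  · intro hcT
    by_contra hcon
    push Not at hcon
    exact hcT (Or.inr (hZ0 ⟨rfl, hcNS, hcon⟩))
  · rintro x (hx | hx) hxS
    · exact absurd hx hxS
    · exact (hZW hx).2

/-- recovering `S` from its image under `exf` -/
lemma rec_f (h : Ok adj P) {S T : Set V} (hS : S ∈ F adj P) {c : V} (hc : c ∈ S)
    (h1 : ∀ x ∈ S, x ≠ c → x ∈ T)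
    (h2 : ∀ x ∈ T, (x ∈ S ∧ x ≠ c) ∨ x ∈ U adj P S c) :
    ∀ x, x ∈ S ↔ x = c ∨ (x ∈ T ∧ ¬ (adj c x ∧ ¬ P c x)) := by
  intro x
  constructor
  · intro hx
    by_cases hxc : x = c
    · exact Or.inl hxc
    · exact Or.inr ⟨h1 x hx hxc, fun hh => hh.2 (F_neg hS hh.1 hc hx)⟩
  · rintro (rfl | ⟨hx, hn⟩)
    · exact hc
    · rcases h2 x hx with hh | hh
      · exact hh.1
      · exact absurd ⟨U_adj h hS hh, fun hp => hh.1 c (h.ps _ _ hp)⟩ hn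

lemma card_le [Finite V] {A B : Set (Set V)} (f : Set V → Set V) (hf : ∀ S ∈ A, f S ∈ B)
    (hi : ∀ S ∈ A, ∀ S' ∈ A, f S = f S' → S = S') : A.ncard ≤ B.ncard :=
  Set.ncard_le_ncard_of_injOn f hf (fun S hS S' hS' e => hi S hS S' hS' e) (Set.toFinite _)

lemma step1 [Finite V] (h : Ok adj P) {c d : V} (hd : P c d)
    (hstar : ∀ e, P c e → ∃ y, P e y ∧ y ≠ c) :
    (F adj P).ncard ≤ (F adj (del P c)).ncard := by
  have hf : ∀ S, ∃ T, S ∈ F adj P → c ∈ S → T ∈ F adj (del P c) ∧ (∀ x ∈ S, x ≠ c → x ∈ T) ∧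
      c ∉ T ∧ ∀ x ∈ T, (x ∈ S ∧ x ≠ c) ∨ x ∈ U adj P S c := by
    intro S
    by_cases hh : S ∈ F adj P ∧ c ∈ S
    · obtain ⟨T, hT⟩ := exf h hh.1 hh.2 hd
      exact ⟨T, fun _ _ => hT⟩
    · exact ⟨∅, fun a b => absurd ⟨a, b⟩ hh⟩
  have hg : ∀ S, ∃ T, S ∈ F adj P → c ∉ S → T ∈ F adj (del P c) ∧
      (∀ x, x ∈ S ↔ x ∈ T ∧ x ∉ NS P c) := by
    intro S
    by_cases hh : S ∈ F adj P ∧ c ∉ S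
    · obtain ⟨T, hT⟩ := exg h hh.1 hh.2 hd
      exact ⟨T, fun _ _ => ⟨hT.1, hT.2.1⟩⟩
    · exact ⟨∅, fun a b => absurd ⟨a, b⟩ hh⟩
  choose f hf using hf
  choose g hg using hg
  have hdc : d ≠ c := by rintro rfl; exact h.ai _ (h.le _ _ hd)
  have key : ∀ S ∈ F adj P, ∀ S' ∈ F adj P, c ∈ S → c ∉ S' → f S ≠ g S' := by
    intro S hS S' hS' hc hc' e
    have h1 : d ∈ f S := (hf S hS hc).2.1 d (F_pos hS (h.ps _ _ hd) hc) hdc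
    rw [e] at h1
    have h2 : d ∉ S' := fun hh => hc' (F_pos hS' hd hh)
    apply h2
    rw [(hg S' hS' hc').2 d]
    refine ⟨h1, fun hn => ?_⟩
    obtain ⟨y, hy, hyc⟩ := hstar d hd
    exact hn.2 y ⟨hy, hdc, hyc⟩
  apply card_le (fun S => if c ∈ S then f S else g S)
  · intro S hS
    beta_reduce
    split_ifs with hc
    · exact (hf S hS hc).1
    · exact (hg S hS hc).1
  · intro S hS S' hS' e
    beta_reduce at e
    split_ifs at e with hc hc' hc'
    · obtain ⟨-, a1, -, a2⟩ := hf S hS hc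
      obtain ⟨-, b1, -, b2⟩ := hf S' hS' hc'
      ext x
      rw [rec_f h hS hc a1 a2, rec_f h hS' hc' b1 b2, e]
    · exact absurd e (key S hS S' hS' hc hc')
    · exact absurd e.symm (key S' hS' S hS hc' hc)
    · ext x
      rw [(hg S hS hc).2, (hg S' hS' hc').2, e]

/-- `P` is a matching -/
def Mat (P : V → V → Prop) : Prop := ∀ x y z, P x y → P x z → y = z

lemma Mat.del (hm : Mat P) (c : V) : Mat (del P c) := fun x y z h1 h2 => hm x y z h1.1 h2.1

lemma del_eq (h : Ok adj P) (hm : Mat P) {a b : V} (hab : P a b) : del P a = del P b := by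
  funext x y
  apply propext
  constructor
  · rintro ⟨hp, hx, hy⟩
    refine ⟨hp, ?_, ?_⟩
    · rintro rfl; exact hy (hm _ _ _ hp (h.ps _ _ hab))
    · rintro rfl; exact hx (hm _ _ _ (h.ps _ _ hp) (h.ps _ _ hab))
  · rintro ⟨hp, hx, hy⟩
    refine ⟨hp, ?_, ?_⟩
    · rintro rfl; exact hy (hm _ _ _ hp hab)
    · rintro rfl; exact hx (hm _ _ _ (h.ps _ _ hp) hab)

lemma step2 [Finite V] (h : Ok adj P) (hm : Mat P) {a b : V} (hab : P a b)
    (hno : ∀ w x, IsInducedC4 adj a b w x → (∀ y, ¬ P w y) → (∀ y, ¬ P x y) → False) :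
    (F adj P).ncard ≤ (F adj (del P b)).ncard := by
  have hba := h.ps _ _ hab
  have hne : a ≠ b := by rintro rfl; exact h.ai _ (h.le _ _ hab)
  have hf : ∀ c d, P c d → ∀ S, ∃ T, S ∈ F adj P → c ∈ S → T ∈ F adj (del P c) ∧
      (∀ x ∈ S, x ≠ c → x ∈ T) ∧ c ∉ T ∧ ∀ x ∈ T, (x ∈ S ∧ x ≠ c) ∨ x ∈ U adj P S c := by
    intro c d hd S
    by_cases hh : S ∈ F adj P ∧ c ∈ S
    · obtain ⟨T, hT⟩ := exf h hh.1 hh.2 hd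
      exact ⟨T, fun _ _ => hT⟩
    · exact ⟨∅, fun a b => absurd ⟨a, b⟩ hh⟩
  have hg : ∀ S, ∃ T, S ∈ F adj P → b ∉ S → T ∈ F adj (del P b) ∧
      (∀ x, x ∈ S ↔ x ∈ T ∧ x ∉ NS P b) ∧
      (b ∉ T → ∃ s ∈ S, adj b s) ∧ (∀ x ∈ T, x ∉ S → ∀ s ∈ S, ¬ adj x s) := by
    intro S
    by_cases hh : S ∈ F adj P ∧ b ∉ S
    · obtain ⟨T, hT⟩ := exg h hh.1 hh.2 hba
      exact ⟨T, fun _ _ => hT⟩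
    · exact ⟨∅, fun a b => absurd ⟨a, b⟩ hh⟩
  choose fb hfb using hf b a hba
  choose fa hfa using hf a b hab
  choose g hg using hg
  have mem : ∀ S ∈ F adj P, b ∈ S → a ∈ S := fun S hS hb => F_pos hS hab hb
  have mem' : ∀ S ∈ F adj P, b ∉ S → a ∉ S := fun S hS hb ha => hb (F_pos hS hba ha)
  -- vertices without positive neighbours outside a fixed set have a neighbour inside
  have out : ∀ S ∈ F adj P, ∀ v, (∀ y, ¬ P v y) → v ∉ S → ∃ t ∈ S, adj v t := by
    intro S hS v hv hvS
    rcases F_out hS hvS with ⟨u, hu, _⟩ | ⟨u, hu, hu2, hm⟩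
    · exact absurd (h.ps _ _ hu) (hv u)
    · exact ⟨u, hm, h.as _ _ hu⟩
  let C : Set V → Prop := fun S => (U adj P S a).Nonempty ∨ ¬ (U adj P S b).Nonempty
  have key1 : ∀ S ∈ F adj P, ∀ S' ∈ F adj P, b ∈ S → b ∉ S' → C S → fb S ≠ g S' := by
    intro S hS S' hS' hb hb' hC e
    obtain ⟨-, p1, p2, p3⟩ := hfb S hS hb
    obtain ⟨-, q1, q2, q3⟩ := hg S' hS' hb'
    have ha' := mem' S' hS' hb'
    have haT : a ∈ g S' := e ▸ p1 a (mem S hS hb) hne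
    have sub : ∀ t ∈ S', t ∈ fb S := fun t ht => by rw [e]; exact ((q1 t).1 ht).1
    obtain ⟨s, hs, hbs⟩ := q2 (e ▸ p2)
    have hsU : s ∈ U adj P S b := by
      rcases p3 s (sub s hs) with hh | hh
      · have := F_neg hS hbs hb hh.1
        have := hm _ _ _ this hba
        subst this
        exact absurd hs ha'
      · exact hh
    rcases hC with ⟨y, hy⟩ | hC
    · have hay := U_adj h hS hy
      have hyS' : y ∉ S' := fun hh => q3 a haT ha' y hh hay
      obtain ⟨t, ht, hyt⟩ := out S' hS' y hy.1 hyS'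
      have hta : t ≠ a := fun e => ha' (e ▸ ht)
      rcases p3 t (sub t ht) with hh | hh
      · exact hy.2.2 t hh.1 hta hyt
      · have hbt := U_adj h hS hh
        have hat : ¬ adj a t := fun k => hh.2.2 a (mem S hS hb) hne (h.as _ _ k)
        have hby : ¬ adj b y := fun k => hy.2.2 b hb hne.symm (h.as _ _ k)
        refine hno t y ⟨hne, hta.symm, ?_, ?_, ?_, ?_, h.le _ _ hab, hbt, h.as _ _ hyt,
          h.as _ _ hay, hat, hby⟩ hh.1 hy.1
        · rintro rfl; exact h.ai _ hay
        · rintro rfl; exact h.ai _ hbt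
        · rintro rfl; exact hy.2.1 hb
        · rintro rfl; exact h.ai _ hyt
    · exact hC ⟨s, hsU⟩
  have key2 : ∀ S ∈ F adj P, ∀ S' ∈ F adj P, b ∈ S → b ∉ S' → ¬ C S → fa S ≠ g S' := by
    intro S hS S' hS' hb hb' hC e
    obtain ⟨-, p1, p2, p3⟩ := hfa S hS (mem S hS hb)
    obtain ⟨-, q1, q2, q3⟩ := hg S' hS' hb'
    have ha' := mem' S' hS' hb'
    have sub : ∀ t ∈ S', t ∈ fa S := fun t ht => by rw [e]; exact ((q1 t).1 ht).1
    simp only [C, not_or, not_not] at hC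
    obtain ⟨hC1, x, hx⟩ := hC
    have hbT : b ∈ g S' := e ▸ p1 b hb hne.symm
    have hbx := U_adj h hS hx
    have hxS' : x ∉ S' := fun hh => q3 b hbT hb' x hh hbx
    obtain ⟨t, ht, hxt⟩ := out S' hS' x hx.1 hxS'
    rcases p3 t (sub t ht) with hh | hh
    · exact hx.2.2 t hh.1 (fun e => hb' (e ▸ ht)) hxt
    · exact hC1 ⟨t, hh⟩
  have key3 : ∀ S ∈ F adj P, ∀ S' ∈ F adj P, b ∈ S → b ∈ S' → fb S ≠ fa S' := by
    intro S hS S' hS' hb hb' e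
    have := (hfb S hS hb).2.1 a (mem S hS hb) hne
    rw [e] at this
    exact (hfa S' hS' (mem S' hS' hb')).2.2.1 this
  have injb : ∀ S ∈ F adj P, ∀ S' ∈ F adj P, b ∈ S → b ∈ S' → fb S = fb S' → S = S' := by
    intro S hS S' hS' hc hc' e
    obtain ⟨-, a1, -, a2⟩ := hfb S hS hc
    obtain ⟨-, b1, -, b2⟩ := hfb S' hS' hc'
    ext x
    rw [rec_f h hS hc a1 a2, rec_f h hS' hc' b1 b2, e]
  have inja : ∀ S ∈ F adj P, ∀ S' ∈ F adj P, a ∈ S → a ∈ S' → fa S = fa S' → S = S' := by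
    intro S hS S' hS' hc hc' e
    obtain ⟨-, a1, -, a2⟩ := hfa S hS hc
    obtain ⟨-, b1, -, b2⟩ := hfa S' hS' hc'
    ext x
    rw [rec_f h hS hc a1 a2, rec_f h hS' hc' b1 b2, e]
  apply card_le (fun S => if b ∈ S then (if C S then fb S else fa S) else g S)
  · intro S hS
    beta_reduce
    split_ifs with hc hC
    · exact (hfb S hS hc).1
    · rw [← del_eq h hm hab]
      exact (hfa S hS (mem S hS hc)).1
    · exact (hg S hS hc).1
  · intro S hS S' hS' e
    beta_reduce at e
    by_cases hb : b ∈ S <;> by_cases hb' : b ∈ S'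
    · rw [if_pos hb, if_pos hb'] at e
      by_cases hC : C S <;> by_cases hC' : C S'
      · rw [if_pos hC, if_pos hC'] at e
        exact injb S hS S' hS' hb hb' e
      · rw [if_pos hC, if_neg hC'] at e
        exact absurd e (key3 S hS S' hS' hb hb')
      · rw [if_neg hC, if_pos hC'] at e
        exact absurd e.symm (key3 S' hS' S hS hb' hb)
      · rw [if_neg hC, if_neg hC'] at e
        exact inja S hS S' hS' (mem S hS hb) (mem S' hS' hb') e
    · rw [if_pos hb, if_neg hb'] at e
      by_cases hC : C S
      · rw [if_pos hC] at e
        exact absurd e (key1 S hS S' hS' hb hb' hC)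
      · rw [if_neg hC] at e
        exact absurd e (key2 S hS S' hS' hb hb' hC)
    · rw [if_neg hb, if_pos hb'] at e
      by_cases hC : C S'
      · rw [if_pos hC] at e
        exact absurd e.symm (key1 S' hS' S hS hb' hb hC)
      · rw [if_neg hC] at e
        exact absurd e.symm (key2 S' hS' S hS hb' hb hC)
    · rw [if_neg hb, if_neg hb'] at e
      ext x
      rw [(hg S hS hb).2.1, (hg S' hS' hb').2.1, e]

lemma card_f [Finite V] (h : Ok adj P) {c d : V} (hd : P c d) :
    {S | S ∈ F adj P ∧ c ∈ S}.ncard ≤ {T | T ∈ F adj (del P c) ∧ c ∉ T ∧ d ∈ T}.ncard := by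
  have hdc : d ≠ c := by rintro rfl; exact h.ai _ (h.le _ _ hd)
  have hf : ∀ S, ∃ T, S ∈ F adj P → c ∈ S → T ∈ F adj (del P c) ∧ (∀ x ∈ S, x ≠ c → x ∈ T) ∧
      c ∉ T ∧ ∀ x ∈ T, (x ∈ S ∧ x ≠ c) ∨ x ∈ U adj P S c := by
    intro S
    by_cases hh : S ∈ F adj P ∧ c ∈ S
    · obtain ⟨T, hT⟩ := exf h hh.1 hh.2 hd
      exact ⟨T, fun _ _ => hT⟩
    · exact ⟨∅, fun a b => absurd ⟨a, b⟩ hh⟩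
  choose f hf using hf
  apply card_le f
  · rintro S ⟨hS, hc⟩
    obtain ⟨a0, a1, a2, a3⟩ := hf S hS hc
    exact ⟨a0, a2, a1 d (F_pos hS (h.ps _ _ hd) hc) hdc⟩
  · rintro S ⟨hS, hc⟩ S' ⟨hS', hc'⟩ e
    obtain ⟨-, a1, -, a2⟩ := hf S hS hc
    obtain ⟨-, b1, -, b2⟩ := hf S' hS' hc'
    ext x
    rw [rec_f h hS hc a1 a2, rec_f h hS' hc' b1 b2, e]

lemma card_g [Finite V] (h : Ok adj P) {c d : V} (hd : P c d) :
    {S | S ∈ F adj P ∧ c ∉ S}.ncard ≤ (F adj (del P c)).ncard := by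
  have hg : ∀ S, ∃ T, S ∈ F adj P → c ∉ S → T ∈ F adj (del P c) ∧
      (∀ x, x ∈ S ↔ x ∈ T ∧ x ∉ NS P c) := by
    intro S
    by_cases hh : S ∈ F adj P ∧ c ∉ S
    · obtain ⟨T, hT⟩ := exg h hh.1 hh.2 hd
      exact ⟨T, fun _ _ => ⟨hT.1, hT.2.1⟩⟩
    · exact ⟨∅, fun a b => absurd ⟨a, b⟩ hh⟩
  choose g hg using hg
  apply card_le g
  · rintro S ⟨hS, hc⟩
    exact (hg S hS hc).1
  · rintro S ⟨hS, hc⟩ S' ⟨hS', hc'⟩ e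
    ext x
    rw [(hg S hS hc).2, (hg S' hS' hc').2, e]

lemma step3 [Finite V] (h : Ok adj P) (hm : Mat P) {a b : V} (hab : P a b) :
    2 * (F adj P).ncard ≤ 3 * (F adj (del P b)).ncard := by
  have hba := h.ps _ _ hab
  have h1 := card_f h hba
  have h2 := card_f h hab
  have h3 := card_g h hba
  rw [del_eq h hm hab] at h2
  have e1 : {S | S ∈ F adj P ∧ a ∈ S} = {S | S ∈ F adj P ∧ b ∈ S} := by
    ext S
    exact ⟨fun hh => ⟨hh.1, F_pos hh.1 hba hh.2⟩, fun hh => ⟨hh.1, F_pos hh.1 hab hh.2⟩⟩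
  rw [e1] at h2
  have h4 : {T | T ∈ F adj (del P b) ∧ b ∉ T ∧ a ∈ T}.ncard +
      {T | T ∈ F adj (del P b) ∧ a ∉ T ∧ b ∈ T}.ncard ≤ (F adj (del P b)).ncard := by
    rw [← Set.ncard_union_eq _ (Set.toFinite _) (Set.toFinite _)]
    · apply Set.ncard_le_ncard _ (Set.toFinite _)
      rintro T (hT | hT) <;> exact hT.1
    · rw [Set.disjoint_left]
      rintro T hT hT'
      exact hT.2.1 hT'.2.2
  have h5 : (F adj P).ncard ≤ {S | S ∈ F adj P ∧ b ∈ S}.ncard +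
      {S | S ∈ F adj P ∧ b ∉ S}.ncard := by
    refine le_trans (Set.ncard_le_ncard ?_ (Set.toFinite _)) (Set.ncard_union_le _ _)
    intro S hS
    by_cases hb : b ∈ S
    · exact Or.inl ⟨hS, hb⟩
    · exact Or.inr ⟨hS, hb⟩
  omega

lemma del_lt [Finite V] {c d : V} (hd : P c d) :
    {p : V × V | del P c p.1 p.2}.ncard < {p : V × V | P p.1 p.2}.ncard := by
  apply Set.ncard_lt_ncard _ (Set.toFinite _)
  rw [Set.ssubset_iff_of_subset (fun p hp => hp.1)]
  exact ⟨(c, d), hd, fun hh => hh.2.1 rfl⟩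

lemma reduce [Finite V] (n : ℕ) : ∀ P : V → V → Prop, Ok adj P →
    {p : V × V | P p.1 p.2}.ncard = n →
    ∃ Q, Ok adj Q ∧ Mat Q ∧ (F adj P).ncard ≤ (F adj Q).ncard ∧
      ∀ a b, Q a b → ∃ w x, IsInducedC4 adj a b w x ∧ (∀ y, ¬ Q w y) ∧ (∀ y, ¬ Q x y) := by
  induction n using Nat.strong_induction_on with
  | _ n ih =>
    intro P h hn
    have fin : ∀ c d, P c d → (F adj P).ncard ≤ (F adj (del P c)).ncard →
        ∃ Q, Ok adj Q ∧ Mat Q ∧ (F adj P).ncard ≤ (F adj Q).ncard ∧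
        ∀ a b, Q a b → ∃ w x, IsInducedC4 adj a b w x ∧ (∀ y, ¬ Q w y) ∧ (∀ y, ¬ Q x y) := by
      intro c d hd hle
      obtain ⟨Q, h1, h2, h3, h4⟩ := ih _ (hn ▸ del_lt hd) (del P c) (h.del c) rfl
      exact ⟨Q, h1, h2, hle.trans h3, h4⟩
    by_cases h1 : ∃ c d, P c d ∧ ∀ e, P c e → ∃ y, P e y ∧ y ≠ c
    · obtain ⟨c, d, hd, hs⟩ := h1
      exact fin c d hd (step1 h hd hs)
    push Not at h1
    have hm : Mat P := by
      intro x y z hy hz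
      obtain ⟨e, he, he'⟩ := h1 x y hy
      obtain ⟨k, hk, hk'⟩ := h1 e x (h.ps _ _ he)
      have := he' k hk
      subst this
      rw [hk' y hy, hk' z hz]
    by_cases h2 : ∃ a b, P a b ∧
        ∀ w x, IsInducedC4 adj a b w x → (∀ y, ¬ P w y) → (∀ y, ¬ P x y) → False
    · obtain ⟨a, b, hab, hno⟩ := h2
      exact fin b a (h.ps _ _ hab) (step2 h hm hab hno)
    · refine ⟨P, h, hm, le_rfl, ?_⟩
      intro a b hab
      by_contra hcon
      exact h2 ⟨a, b, hab, fun w x k1 k2 k3 => hcon ⟨w, x, k1, k2, k3⟩⟩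

lemma F_empty (h : Ok adj P) (he : ∀ x y, ¬ P x y) : F adj P = {S | IsMaxIndep adj S} := by
  ext S
  constructor
  · intro hS
    refine ⟨fun u hu v hv ha => he _ _ (F_neg hS ha hu hv), fun v hv => ?_⟩
    rcases F_out hS hv with ⟨u, hu, _⟩ | ⟨u, hu, _, hm⟩
    · exact absurd hu (he _ _)
    · exact ⟨u, hm, hu⟩
  · rintro ⟨h1, h2⟩
    apply F_mk
    · intro x y hp
      exact absurd hp (he _ _)
    · intro x y ha hx hy
      exact absurd ha (h1 x hx y hy)
    · intro v hv
      obtain ⟨u, hu, ha⟩ := h2 v hv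
      exact Or.inr ⟨u, ha, he _ _, hu⟩

lemma bound [Finite V] (n : ℕ) : ∀ P : V → V → Prop, Ok adj P → Mat P →
    {p : V × V | P p.1 p.2}.ncard = n →
    ∃ M : Finset (V × V), (∀ p ∈ M, P p.1 p.2) ∧
      (∀ p ∈ M, ∀ q ∈ M, p ≠ q → p.1 ≠ q.1 ∧ p.1 ≠ q.2 ∧ p.2 ≠ q.1 ∧ p.2 ≠ q.2) ∧
      ((F adj P).ncard : ℚ) ≤ (3 / 2 : ℚ) ^ M.card * misc adj := by
  induction n using Nat.strong_induction_on with
  | _ n ih =>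
    intro P h hm hn
    by_cases he : ∃ a b, P a b
    · obtain ⟨a, b, hab⟩ := he
      have hba := h.ps _ _ hab
      obtain ⟨M, h1, h2, h3⟩ := ih _ (hn ▸ del_lt hba) (del P b) (h.del b) (hm.del b) rfl
      have hd : ∀ q ∈ M, a ≠ q.1 ∧ a ≠ q.2 ∧ b ≠ q.1 ∧ b ≠ q.2 := by
        intro q hq
        obtain ⟨k1, k2, k3⟩ := h1 q hq
        refine ⟨?_, ?_, k2.symm, k3.symm⟩
        · intro e
          rw [← e] at k1
          exact k3 (hm _ _ _ k1 hab)
        · intro e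
          rw [← e] at k1
          exact k2 (hm _ _ _ (h.ps _ _ k1) hab)
      have hnot : (a, b) ∉ M := fun hh => (hd _ hh).1 rfl
      refine ⟨insert (a, b) M, ?_, ?_, ?_⟩
      · intro p hp
        rcases Finset.mem_insert.1 hp with rfl | hp
        · exact hab
        · exact (h1 p hp).1
      · intro p hp q hq hpq
        rcases Finset.mem_insert.1 hp with rfl | hp <;> rcases Finset.mem_insert.1 hq with rfl | hq
        · exact absurd rfl hpq
        · exact hd q hq
        · obtain ⟨k1, k2, k3, k4⟩ := hd p hp
          exact ⟨k1.symm, k3.symm, k2.symm, k4.symm⟩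
        · exact h2 p hp q hq hpq
      · rw [Finset.card_insert_of_notMem hnot, pow_succ]
        have h4 : (2 : ℚ) * (F adj P).ncard ≤ 3 * (F adj (del P b)).ncard := by
          exact_mod_cast step3 h hm hab
        linarith
    · push Not at he
      refine ⟨∅, by simp, by simp, ?_⟩
      rw [F_empty h he]
      simp [misc]

end Conj

/-- For every simple signed graph `G`: `fix(G) ≤ (3/2)^{m'(G)} · mis(G)`, where `m'(G)`
is the maximum size of a matching as in `GoodMatchingM'`. -/
theorem stmt12 {V : Type*} [Fintype V] (pos neg : V → V → Prop)
    (hps : Symmetric pos) (hns : Symmetric neg)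
    (hpi : ∀ v, ¬ pos v v) (hni : ∀ v, ¬ neg v v)
    (hd : ∀ u v, pos u v → ¬ neg u v)
    (m' : ℕ)
    (hm' : IsGreatest {n : ℕ | ∃ M : Finset (V × V),
      GoodMatchingM' (fun x y => pos x y ∨ neg x y) M ∧ M.card = n} m') :
    (fixc pos neg : ℚ) ≤
      (3 / 2 : ℚ) ^ m' * misc (fun x y => pos x y ∨ neg x y) := by
  set adj : V → V → Prop := fun x y => pos x y ∨ neg x y with hadj
  have h : Conj.Ok adj pos := by
    refine ⟨?_, ?_, fun x y hx => hps hx, fun x y hx => Or.inl hx⟩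
    · rintro x y (hx | hx)
      · exact Or.inl (hps hx)
      · exact Or.inr (hns hx)
    · rintro x (hx | hx)
      · exact hpi x hx
      · exact hni x hx
  have hneg : (fun x y => adj x y ∧ ¬ pos x y) = neg := by
    funext x y
    apply propext
    constructor
    · rintro ⟨hx | hx, hn⟩
      · exact absurd hx hn
      · exact hx
    · intro hx
      exact ⟨Or.inr hx, fun hp => hd x y hp hx⟩
  have hF : fixc pos neg = (Conj.F adj pos).ncard := by
    unfold fixc Conj.F
    rw [hneg]
  obtain ⟨Q, q1, q2, q3, q4⟩ := Conj.reduce _ pos h rfl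
  obtain ⟨M, m1, m2, m3⟩ := Conj.bound _ Q q1 q2 rfl
  have hM : M.card ≤ m' := by
    apply hm'.2
    refine ⟨M, ⟨fun p hp => q1.le _ _ (m1 p hp), m2, ?_⟩, rfl⟩
    intro p hp
    obtain ⟨w, x, hc, hw, hx⟩ := q4 _ _ (m1 p hp)
    refine ⟨w, x, hc, fun q hq => ⟨?_, ?_, ?_, ?_⟩⟩
    · rintro rfl; exact hw _ (m1 q hq)
    · rintro rfl; exact hw _ (q1.ps _ _ (m1 q hq))
    · rintro rfl; exact hx _ (m1 q hq)
    · rintro rfl; exact hx _ (q1.ps _ _ (m1 q hq))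
  rw [hF]
  calc ((Conj.F adj pos).ncard : ℚ) ≤ (Conj.F adj Q).ncard := by exact_mod_cast q3
    _ ≤ (3 / 2 : ℚ) ^ M.card * misc adj := m3
    _ ≤ (3 / 2 : ℚ) ^ m' * misc adj := by
      gcongr
      norm_num
end

section
/- For every graph G, mis(G) ≤ max over symmetric signings σ of fix(G_σ) ≤ (3/2)^{m(G)} · mis(G), where m(G) is the maximum size of a matching M of G such that every edge of M is contained in an induced copy of C₄ containing no other edge of M. In particular, if G has no induced C₄, then max_σ fix(G_σ) = mis(G). -/
/-- Positive arcs of the signing `σ` (`true` = positive) of the graph `G`. -/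
def posOf {V : Type*} (G : SimpleGraph V) (σ : V → V → Bool) : V → V → Prop :=
  fun u v => G.Adj u v ∧ σ u v = true

/-- Negative arcs of the signing `σ` of the graph `G`. -/
def negOf {V : Type*} (G : SimpleGraph V) (σ : V → V → Bool) : V → V → Prop :=
  fun u v => G.Adj u v ∧ σ u v = false

/-- `M` is a matching such that every edge of `M` lies in an induced 4-cycle
containing no other edge of `M`. -/
def GoodMatchingM {V : Type*} (adj : V → V → Prop) (M : Finset (V × V)) : Prop :=
  (∀ p ∈ M, adj p.1 p.2) ∧
  (∀ p ∈ M, ∀ q ∈ M, p ≠ q → p.1 ≠ q.1 ∧ p.1 ≠ q.2 ∧ p.2 ≠ q.1 ∧ p.2 ≠ q.2) ∧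
  (∀ p ∈ M, ∃ w x, IsInducedC4 adj p.1 p.2 w x ∧
    (p.2, w) ∉ M ∧ (w, p.2) ∉ M ∧ (w, x) ∉ M ∧ (x, w) ∉ M ∧
    (x, p.1) ∉ M ∧ (p.1, x) ∉ M)

open Classical in
theorem ncard_le_of_rel {α : Type*} [Finite α] (A B : Set α) (R : α → α → Prop)
    (h1 : ∀ S ∈ A, ∃ T ∈ B, R S T)
    (h2 : ∀ S ∈ A, ∀ S' ∈ A, ∀ T ∈ B, R S T → R S' T → S = S') : A.ncard ≤ B.ncard := by
  choose! f hf hR using h1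
  refine Set.ncard_le_ncard_of_injOn f hf ?_ (Set.toFinite B)
  intro S hS S' hS' he
  have hR2 : R S' (f S) := he ▸ hR S' hS'
  exact h2 S hS S' hS' (f S) (hf S hS) (hR S hS) hR2

/-- Fixed sets, given the graph `P` of positive edges. -/
def Fx {V : Type*} (G P : SimpleGraph V) : Set (Set V) :=
  {S | (∀ u v, P.Adj u v → u ∈ S → v ∈ S) ∧
    (∀ u ∈ S, ∀ v ∈ S, G.Adj u v → P.Adj u v) ∧
    (∀ v, v ∉ S → (∀ u, ¬ P.Adj u v) → ∃ u ∈ S, G.Adj u v)}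

/-- Remove all edges at `c`. -/
def remV {V : Type*} (P : SimpleGraph V) (c : V) : SimpleGraph V where
  Adj u v := P.Adj u v ∧ u ≠ c ∧ v ≠ c
  symm := ⟨fun _ _ h => ⟨h.1.symm, h.2.2, h.2.1⟩⟩
  loopless := ⟨fun _ h => h.1.ne rfl⟩

theorem exists_ext {V : Type*} [Fintype V] (G P : SimpleGraph V) (R : Set V)
    (h1 : ∀ u v, P.Adj u v → u ∈ R → v ∈ R)
    (h2 : ∀ u ∈ R, ∀ v ∈ R, G.Adj u v → P.Adj u v) :
    ∃ T ∈ Fx G P, R ⊆ T ∧ ∀ v ∈ T, v ∉ R →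
      (∀ u, ¬ P.Adj u v) ∧ ∀ u ∈ R, ¬ G.Adj u v := by
  let Q : Set (Set V) := {T | (∀ u v, P.Adj u v → u ∈ T → v ∈ T) ∧
    (∀ u ∈ T, ∀ v ∈ T, G.Adj u v → P.Adj u v) ∧ R ⊆ T ∧ ∀ v ∈ T, v ∉ R →
      (∀ u, ¬ P.Adj u v) ∧ ∀ u ∈ R, ¬ G.Adj u v}
  have hQ : R ∈ Q := ⟨h1, h2, subset_rfl, fun v hv hn => absurd hv hn⟩
  obtain ⟨T, hT⟩ := (Set.toFinite Q).exists_maximal ⟨R, hQ⟩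
  obtain ⟨⟨t1, t2, t3, t4⟩, hmax⟩ := hT
  refine ⟨T, ⟨t1, t2, ?_⟩, t3, t4⟩
  intro v hv hiso
  by_contra hcon
  push Not at hcon
  have hin : insert v T ∈ Q := by
    refine ⟨?_, ?_, t3.trans (Set.subset_insert _ _), ?_⟩
    · rintro x y hxy (rfl | hx)
      · exact absurd hxy.symm (hiso y)
      · exact Or.inr (t1 x y hxy hx)
    · rintro x (rfl | hx) y (rfl | hy) hxy
      · exact absurd rfl hxy.ne
      · exact absurd hxy.symm (hcon y hy)
      · exact absurd hxy (hcon x hx)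
      · exact t2 x hx y hy hxy
    · rintro x (rfl | hx) hxR
      · exact ⟨hiso, fun u hu => hcon u (t3 hu)⟩
      · exact t4 x hx hxR
  exact hv (hmax hin (Set.subset_insert _ _) (Set.mem_insert _ _))

theorem L1 {V : Type*} [Fintype V] (G P : SimpleGraph V) (hPG : P ≤ G) (c b : V)
    (hcb : P.Adj c b) (S : Set V) (hS : S ∈ Fx G P) (hc : c ∈ S) :
    ∃ T ∈ Fx G (remV P c), c ∉ T ∧ b ∈ T ∧ (∀ v ∈ S, v ≠ c → v ∈ T) ∧
      S = {v | (v ∈ T ∧ ¬ G.Adj c v) ∨ v = c ∨ P.Adj c v} ∧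
      ∀ v ∈ T, v ∉ S → (∀ u, ¬ P.Adj u v) ∧ G.Adj c v ∧ ∀ u ∈ S, u ≠ c → ¬ G.Adj u v := by
  obtain ⟨s1, s2, s3⟩ := hS
  obtain ⟨T, hT, hRT, hx⟩ := exists_ext G (remV P c) {v | v ∈ S ∧ v ≠ c}
    (fun u v huv hu => ⟨s1 u v huv.1 hu.1, huv.2.2⟩)
    (fun u hu v hv huv => ⟨s2 u hu.1 v hv.1 huv, hu.2, hv.2⟩)
  have hb : b ∈ S := s1 c b hcb hc
  have hbc : b ≠ c := hcb.ne.symm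
  have hcT : c ∉ T := fun h =>
    (hx c h (fun h' => h'.2 rfl)).2 b ⟨hb, hbc⟩ (hPG hcb).symm
  have key : ∀ v ∈ T, v ∉ S → (∀ u, ¬ P.Adj u v) ∧ G.Adj c v ∧
      ∀ u ∈ S, u ≠ c → ¬ G.Adj u v := by
    intro v hv hvS
    obtain ⟨k1, k2⟩ := hx v hv (fun h => hvS h.1)
    have hvc : v ≠ c := fun h => hcT (h ▸ hv)
    have hiso : ∀ u, ¬ P.Adj u v := by
      intro u hu
      by_cases huc : u = c
      · exact hvS (s1 u v hu (huc ▸ hc))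
      · exact k1 u ⟨hu, huc, hvc⟩
    obtain ⟨u, hu, huv⟩ := s3 v hvS hiso
    refine ⟨hiso, ?_, fun u hu hne => k2 u ⟨hu, hne⟩⟩
    by_cases huc : u = c
    · exact huc ▸ huv
    · exact absurd huv (k2 u ⟨hu, huc⟩)
  refine ⟨T, hT, hcT, hRT ⟨hb, hbc⟩, fun v h1 h2 => hRT ⟨h1, h2⟩, ?_, key⟩
  ext v
  constructor
  · intro hv
    by_cases hvc : v = c
    · exact Or.inr (Or.inl hvc)
    · by_cases ha : G.Adj c v
      · exact Or.inr (Or.inr (s2 c hc v hv ha))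
      · exact Or.inl ⟨hRT ⟨hv, hvc⟩, ha⟩
  · rintro (⟨h1, h2⟩ | rfl | h)
    · by_contra hvS
      exact h2 (key v h1 hvS).2.1
    · exact hc
    · exact s1 c v h hc

theorem L0 {V : Type*} [Fintype V] (G P : SimpleGraph V) (c : V)
    (S : Set V) (hS : S ∈ Fx G P) (hc : c ∉ S) :
    ∃ T ∈ Fx G (remV P c), S ⊆ T ∧ S = {v | v ∈ T ∧ v ≠ c ∧ ¬ P.Adj c v} ∧
      ∀ v ∈ T, v ∉ S → (∀ u, ¬ (remV P c).Adj u v) ∧ ∀ u ∈ S, ¬ G.Adj u v := by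
  obtain ⟨s1, s2, s3⟩ := hS
  obtain ⟨T, hT, hRT, hx⟩ := exists_ext G (remV P c) S
    (fun u v huv hu => s1 u v huv.1 hu)
    (fun u hu v hv huv => ⟨s2 u hu v hv huv, fun h => hc (h ▸ hu), fun h => hc (h ▸ hv)⟩)
  refine ⟨T, hT, hRT, ?_, hx⟩
  ext v
  constructor
  · intro hv
    exact ⟨hRT hv, fun h => hc (h ▸ hv), fun h => hc (s1 v c h.symm hv)⟩
  · rintro ⟨h1, h2, h3⟩
    by_contra hvS
    obtain ⟨k1, k2⟩ := hx v h1 hvS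
    obtain ⟨u, hu, huv⟩ := s3 v hvS (by
      intro u hu
      by_cases huc : u = c
      · exact h3 (huc ▸ hu)
      · exact k1 u ⟨hu, huc, h2⟩)
    exact k2 u hu huv

theorem step1 {V : Type*} [Fintype V] (G P : SimpleGraph V) (hPG : P ≤ G) (a b c : V)
    (hcb : P.Adj c b) (hab : P.Adj a b) (hac : a ≠ c) :
    (Fx G P).ncard ≤ (Fx G (remV P c)).ncard := by
  apply ncard_le_of_rel _ _ (fun S T =>
    (b ∈ T ∧ S = {v | (v ∈ T ∧ ¬ G.Adj c v) ∨ v = c ∨ P.Adj c v}) ∨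
    (b ∉ T ∧ S = {v | v ∈ T ∧ v ≠ c ∧ ¬ P.Adj c v}))
  · intro S hS
    by_cases hc : c ∈ S
    · obtain ⟨T, hT, -, h1, -, h2, -⟩ := L1 G P hPG c b hcb S hS hc
      exact ⟨T, hT, Or.inl ⟨h1, h2⟩⟩
    · obtain ⟨T, hT, -, h2, h3⟩ := L0 G P c S hS hc
      refine ⟨T, hT, Or.inr ⟨?_, h2⟩⟩
      intro hb
      by_cases hbS : b ∈ S
      · exact hc (hS.1 b c hcb.symm hbS)
      · exact (h3 b hb hbS).1 a ⟨hab, hac, hcb.ne.symm⟩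
  · rintro S - S' - T - (⟨h1, h2⟩ | ⟨h1, h2⟩) (⟨h3, h4⟩ | ⟨h3, h4⟩)
    · rw [h2, h4]
    · exact absurd h1 h3
    · exact absurd h3 h1
    · rw [h2, h4]

/-- The edges of `P` form a matching. -/
def IsMt {V : Type*} (P : SimpleGraph V) : Prop :=
  ∀ a b c, P.Adj a b → P.Adj c b → a = c

theorem rem_eq {V : Type*} (P : SimpleGraph V) (hM : IsMt P) (a b : V) (hab : P.Adj a b) :
    remV P a = remV P b := by
  ext u v
  constructor
  · rintro ⟨h, h1, h2⟩
    refine ⟨h, ?_, ?_⟩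
    · rintro rfl
      exact h2 (hM _ _ _ h.symm hab)
    · rintro rfl
      exact h1 (hM _ _ _ h hab)
  · rintro ⟨h, h1, h2⟩
    refine ⟨h, ?_, ?_⟩
    · rintro rfl
      exact h2 (hM _ _ _ h.symm hab.symm)
    · rintro rfl
      exact h1 (hM _ _ _ h hab.symm)

theorem step3 {V : Type*} [Fintype V] (G P : SimpleGraph V) (hPG : P ≤ G) (hM : IsMt P)
    (a b : V) (hab : P.Adj a b) :
    2 * (Fx G P).ncard ≤ 3 * (Fx G (remV P a)).ncard := by
  have e1 : (Fx G P ∩ {S | a ∈ S}).ncard ≤ (Fx G (remV P a) ∩ {T | b ∈ T}).ncard := by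
    apply ncard_le_of_rel _ _ (fun S T =>
      S = {v | (v ∈ T ∧ ¬ G.Adj a v) ∨ v = a ∨ P.Adj a v})
    · rintro S ⟨hS, ha⟩
      obtain ⟨T, hT, -, h1, -, h2, -⟩ := L1 G P hPG a b hab S hS ha
      exact ⟨T, ⟨hT, h1⟩, h2⟩
    · intro S _ S' _ T _ h h'
      rw [h, h']
  have e2 : (Fx G P ∩ {S | a ∈ S}).ncard ≤ (Fx G (remV P a) \ {T | b ∈ T}).ncard := by
    apply ncard_le_of_rel _ _ (fun S T =>
      S = {v | (v ∈ T ∧ ¬ G.Adj b v) ∨ v = b ∨ P.Adj b v})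
    · rintro S ⟨hS, ha⟩
      obtain ⟨T, hT, h0, h1, -, h2, -⟩ := L1 G P hPG b a hab.symm S hS (hS.1 a b hab ha)
      rw [rem_eq P hM a b hab]
      exact ⟨T, ⟨hT, h0⟩, h2⟩
    · intro S _ S' _ T _ h h'
      rw [h, h']
  have e3 : (Fx G P \ {S | a ∈ S}).ncard ≤ (Fx G (remV P a)).ncard := by
    apply ncard_le_of_rel _ _ (fun S T => S = {v | v ∈ T ∧ v ≠ a ∧ ¬ P.Adj a v})
    · rintro S ⟨hS, ha⟩
      obtain ⟨T, hT, -, h2, h3⟩ := L0 G P a S hS ha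
      exact ⟨T, hT, h2⟩
    · intro S _ S' _ T _ h h'
      rw [h, h']
  have f1 := Set.ncard_inter_add_ncard_sdiff_eq_ncard (Fx G P) {S | a ∈ S} (Set.toFinite _)
  have f2 := Set.ncard_inter_add_ncard_sdiff_eq_ncard (Fx G (remV P a)) {T | b ∈ T}
    (Set.toFinite _)
  omega

theorem step2 {V : Type*} [Fintype V] (G P : SimpleGraph V) (hPG : P ≤ G) (hM : IsMt P)
    (a b : V) (hab : P.Adj a b)
    (hno : ∀ y x, (∀ u, ¬ P.Adj u y) → (∀ u, ¬ P.Adj u x) → ¬ IsInducedC4 G.Adj a b y x) :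
    (Fx G P).ncard ≤ (Fx G (remV P a)).ncard := by
  have hPa : ∀ v, P.Adj a v ↔ v = b := fun v =>
    ⟨fun h => hM _ _ _ h.symm hab.symm, fun h => h ▸ hab⟩
  have hPb : ∀ v, P.Adj b v ↔ v = a := fun v =>
    ⟨fun h => hM _ _ _ h.symm hab, fun h => h ▸ hab.symm⟩
  have hne := hab.ne
  apply ncard_le_of_rel _ _ (fun S T =>
    (a ∉ S ∧ S = {v | v ∈ T ∧ v ≠ a ∧ ¬ P.Adj a v} ∧ (b ∈ T → ∃ u ∈ S, G.Adj u a)) ∨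
    (a ∈ S ∧ a ∉ T ∧ b ∈ T ∧ S = {v | (v ∈ T ∧ ¬ G.Adj a v) ∨ v = a ∨ P.Adj a v} ∧
      (∀ x ∈ T, x ≠ b → ¬ G.Adj x a)) ∨
    (a ∈ S ∧ a ∈ T ∧ b ∉ T ∧ S = {v | (v ∈ T ∧ ¬ G.Adj b v) ∨ v = b ∨ P.Adj b v} ∧
      {v | v ∈ T ∧ v ≠ a ∧ ¬ P.Adj a v} ∉ Fx G P))
  · intro S hS
    by_cases ha : a ∈ S
    · have hb : b ∈ S := hS.1 a b hab ha
      obtain ⟨B, hB, B1, B2, B3, B4, B5⟩ := L1 G P hPG a b hab S hS ha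
      obtain ⟨A, hA, A1, A2, A3, A4, A5⟩ := L1 G P hPG b a hab.symm S hS hb
      by_cases hx : ∀ x ∈ B, x ≠ b → ¬ G.Adj x a
      · exact ⟨B, hB, Or.inr (Or.inl ⟨ha, B1, B2, B4, hx⟩)⟩
      · rw [rem_eq P hM a b hab]
        refine ⟨A, hA, Or.inr (Or.inr ⟨ha, A2, A1, A4, ?_⟩)⟩
        push Not at hx
        obtain ⟨x, hxB, hxb, hxa⟩ := hx
        intro hF
        have hxS : x ∉ S := by
          intro h
          exact hxb ((hPa x).1 (hS.2.1 a ha x h hxa.symm))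
        obtain ⟨x1, x2, x3⟩ := B5 x hxB hxS
        have hxA : x ∉ A := by
          intro h
          exact x1 _ (hA.2.1 a A2 x h hxa.symm).1
        obtain ⟨y, ⟨hyA, hya, -⟩, hyx⟩ := hF.2.2 x (fun h => hxA h.1) x1
        have hyS : y ∉ S := fun h => x3 y h hya hyx
        obtain ⟨y1, y2, y3⟩ := A5 y hyA hyS
        have hay := y3 a ha hne
        have hbx := x3 b hb hne.symm
        exact hno y x y1 x1 ⟨hne, hya.symm, hxa.ne.symm, y2.ne, hxb.symm, hyx.ne,
          hPG hab, y2, hyx, hxa, hay, hbx⟩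
    · by_cases hd : ∃ u ∈ S, G.Adj u a
      · obtain ⟨T, hT, -, h2, h3⟩ := L0 G P a S hS ha
        exact ⟨T, hT, Or.inl ⟨ha, h2, fun _ => hd⟩⟩
      · have hbS : b ∉ S := fun h => ha (hS.1 b a hab.symm h)
        have hd' : ∀ u ∈ S, ¬ G.Adj u a := fun u hu h => hd ⟨u, hu, h⟩
        refine ⟨insert a S, ⟨?_, ?_, ?_⟩, Or.inl ⟨ha, ?_, ?_⟩⟩
        · rintro u v huv (rfl | hu)
          · exact absurd rfl huv.2.1
          · exact Or.inr (hS.1 u v huv.1 hu)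
        · rintro u (rfl | hu) v (rfl | hv) huv
          · exact absurd rfl huv.ne
          · exact absurd huv.symm (hd' v hv)
          · exact absurd huv (hd' u hu)
          · exact ⟨hS.2.1 u hu v hv huv, fun h => ha (h ▸ hu), fun h => ha (h ▸ hv)⟩
        · intro v hv hiso
          by_cases hvb : v = b
          · exact ⟨a, Or.inl rfl, hvb ▸ hPG hab⟩
          · have hva : v ≠ a := fun h => hv (Or.inl h)
            obtain ⟨u, hu, huv⟩ := hS.2.2 v (fun h => hv (Or.inr h)) (by
              intro u hu
              by_cases hua : u = a
              · exact hvb ((hPa v).1 (hua ▸ hu))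
              · exact hiso u ⟨hu, hua, hva⟩)
            exact ⟨u, Or.inr hu, huv⟩
        · ext v
          simp only [Set.mem_ofPred_eq, Set.mem_insert_iff, hPa]
          constructor
          · intro hv
            exact ⟨Or.inr hv, fun h => ha (h ▸ hv), fun h => hbS (h ▸ hv)⟩
          · rintro ⟨h | h, h1, -⟩
            · exact absurd h h1
            · exact h
        · rintro (h | h)
          · exact absurd h.symm hne
          · exact absurd h hbS
  · rintro S hS S' hS' T -
      (⟨h1, h2, h3⟩ | ⟨h1, h2, h3, h4, h5⟩ | ⟨h1, h2, h3, h4, h5⟩)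
      (⟨k1, k2, k3⟩ | ⟨k1, k2, k3, k4, k5⟩ | ⟨k1, k2, k3, k4, k5⟩)
    · rw [h2, k2]
    · obtain ⟨u, hu, hua⟩ := h3 k3
      rw [h2] at hu
      exact absurd hua (k5 u hu.1 (fun h => hu.2.2 (h ▸ hab)))
    · exact absurd (h2 ▸ hS) k5
    · obtain ⟨u, hu, hua⟩ := k3 h3
      rw [k2] at hu
      exact absurd hua (h5 u hu.1 (fun h => hu.2.2 (h ▸ hab)))
    · rw [h4, k4]
    · exact absurd k2 h2
    · exact absurd (k2 ▸ hS') h5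
    · exact absurd h2 k2
    · rw [h4, k4]

theorem rem_card {V : Type*} [Fintype V] (P : SimpleGraph V) (a b : V) (hab : P.Adj a b) :
    (remV P a).edgeSet.ncard < P.edgeSet.ncard := by
  apply Set.ncard_lt_ncard _ (Set.toFinite _)
  apply SimpleGraph.edgeSet_strict_mono
  refine lt_of_le_of_ne (fun u v h => h.1) ?_
  intro h
  have : (remV P a).Adj a b := by rw [h]; exact hab
  exact this.2.1 rfl

theorem bound3 {V : Type*} [Fintype V] (G : SimpleGraph V) (n : ℕ) :
    ∀ P : SimpleGraph V, P ≤ G → IsMt P → P.edgeSet.ncard ≤ n →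
      ((Fx G P).ncard : ℚ) ≤ (3 / 2 : ℚ) ^ n * (Fx G ⊥).ncard := by
  induction n with
  | zero =>
    intro P hPG hM hc
    by_cases h : ∃ a b, P.Adj a b
    · obtain ⟨a, b, hab⟩ := h
      have := rem_card P a b hab
      omega
    · have : P = ⊥ := by
        ext u v
        simpa using fun h' => h ⟨u, v, h'⟩
      simp [this]
  | succ n ih =>
    intro P hPG hM hc
    by_cases h : ∃ a b, P.Adj a b
    · obtain ⟨a, b, hab⟩ := h
      have h1 := rem_card P a b hab
      have h2 := ih (remV P a) (fun u v h => hPG h.1)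
        (fun x y z hxy hzy => hM x y z hxy.1 hzy.1) (by omega)
      have h3 : (2 : ℚ) * (Fx G P).ncard ≤ 3 * (Fx G (remV P a)).ncard := by
        exact_mod_cast step3 G P hPG hM a b hab
      rw [pow_succ]
      linarith
    · have : P = ⊥ := by
        ext u v
        simpa using fun h' => h ⟨u, v, h'⟩
      rw [this]
      exact le_mul_of_one_le_left (by positivity) (one_le_pow₀ (by norm_num))

theorem good_le {V : Type*} [Fintype V] (G P : SimpleGraph V) (hPG : P ≤ G) (hM : IsMt P)
    (hg : ∀ a b, P.Adj a b → ∃ y x, (∀ u, ¬ P.Adj u y) ∧ (∀ u, ¬ P.Adj u x) ∧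
      IsInducedC4 G.Adj a b y x) :
    ∃ M : Finset (V × V), GoodMatchingM G.Adj M ∧ M.card = P.edgeSet.ncard := by
  classical
  let M : Finset (V × V) := P.edgeFinset.image (fun e : Sym2 V => Quot.out e)
  have hout : ∀ e : Sym2 V, s((Quot.out e).1, (Quot.out e).2) = e := fun e => Quot.out_eq e
  have hmem : ∀ p ∈ M, P.Adj p.1 p.2 ∧ Quot.out s(p.1, p.2) = p := by
    intro p hp
    obtain ⟨e, he, rfl⟩ := Finset.mem_image.1 hp
    rw [SimpleGraph.mem_edgeFinset] at he
    have := hout e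
    refine ⟨?_, by rw [this]⟩
    rw [← SimpleGraph.mem_edgeSet, this]
    exact he
  refine ⟨M, ⟨fun p hp => hPG (hmem p hp).1, ?_, ?_⟩, ?_⟩
  · intro p hp q hq hpq
    obtain ⟨p1, p2⟩ := hmem p hp
    obtain ⟨q1, q2⟩ := hmem q hq
    have key : s(p.1, p.2) ≠ s(q.1, q.2) := by
      intro h
      rw [h] at p2
      exact hpq (p2.symm.trans q2)
    refine ⟨fun h => key ?_, fun h => key ?_, fun h => key ?_, fun h => key ?_⟩
    · have := hM _ _ _ p1.symm (h ▸ q1.symm)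
      rw [h, this]
    · have := hM _ _ _ p1.symm (h ▸ q1)
      rw [h, this, Sym2.eq_swap]
    · have := hM _ _ _ p1 (h ▸ q1.symm)
      rw [h, this, Sym2.eq_swap]
    · have := hM _ _ _ p1 (h ▸ q1)
      rw [h, this]
  · intro p hp
    obtain ⟨y, x, hy, hx, hC⟩ := hg _ _ (hmem p hp).1
    exact ⟨y, x, hC, fun h => hy _ (hmem _ h).1, fun h => hy _ (hmem _ h).1.symm,
      fun h => hx _ (hmem _ h).1, fun h => hy _ (hmem _ h).1,
      fun h => hx _ (hmem _ h).1.symm, fun h => hx _ (hmem _ h).1⟩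
  · rw [Finset.card_image_of_injective, ← SimpleGraph.coe_edgeFinset, Set.ncard_coe_finset]
    intro e e' h
    have h : Quot.out e = Quot.out e' := h
    rw [← hout e, ← hout e', h]

theorem bound_all {V : Type*} [Fintype V] (G : SimpleGraph V) (m : ℕ)
    (hm : ∀ M : Finset (V × V), GoodMatchingM G.Adj M → M.card ≤ m) (n : ℕ) :
    ∀ P : SimpleGraph V, P ≤ G → P.edgeSet.ncard = n →
      ((Fx G P).ncard : ℚ) ≤ (3 / 2 : ℚ) ^ m * (Fx G ⊥).ncard := by
  induction n using Nat.strong_induction_on with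
  | _ n ih =>
  intro P hPG hn
  by_cases hM : IsMt P
  · by_cases hg : ∀ a b, P.Adj a b → ∃ y x, (∀ u, ¬ P.Adj u y) ∧ (∀ u, ¬ P.Adj u x) ∧
      IsInducedC4 G.Adj a b y x
    · obtain ⟨M, h1, h2⟩ := good_le G P hPG hM hg
      exact bound3 G m P hPG hM (h2 ▸ hm M h1)
    · push Not at hg
      obtain ⟨a, b, hab, hno⟩ := hg
      have h1 := rem_card P a b hab
      have h2 := ih _ (hn ▸ h1) (remV P a) (fun u v h => hPG h.1) rfl
      have h3 := step2 G P hPG hM a b hab hno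
      exact le_trans (by exact_mod_cast h3) h2
  · unfold IsMt at hM
    push Not at hM
    obtain ⟨a, b, c, hab, hcb, hac⟩ := hM
    have h1 := rem_card P c b hcb
    have h2 := ih _ (hn ▸ h1) (remV P c) (fun u v h => hPG h.1) rfl
    have h3 := step1 G P hPG a b c hcb hab hac
    exact le_trans (by exact_mod_cast h3) h2

theorem Fx_bot {V : Type*} (G : SimpleGraph V) : Fx G ⊥ = {S | IsMaxIndep G.Adj S} := by
  ext S
  simp [Fx, IsMaxIndep]

/-- The graph of positive edges. -/
def posG {V : Type*} (G : SimpleGraph V) (σ : V → V → Bool) (hσ : ∀ u v, σ u v = σ v u) :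
    SimpleGraph V where
  Adj := posOf G σ
  symm := ⟨fun u v h => ⟨h.1.symm, (hσ v u).trans h.2⟩⟩
  loopless := ⟨fun _ h => h.1.ne rfl⟩

theorem Fx_eq {V : Type*} (G : SimpleGraph V) (σ : V → V → Bool) (hσ : ∀ u v, σ u v = σ v u) :
    {S | IsFixedSet (posOf G σ) (negOf G σ) S} = Fx G (posG G σ hσ) := by
  ext S
  constructor
  · intro h
    refine ⟨fun u v huv hu => ?_, fun u hu v hv huv => ?_, fun v hv hiso => ?_⟩
    · exact ((h u).1 hu).1 v (posG G σ hσ |>.symm.symm _ _ huv)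
    · by_contra hn
      have : σ u v = false := by
        by_contra hs
        exact hn ⟨huv, by simpa using hs⟩
      exact ((h v).1 hv).2 u ⟨huv, this⟩ hu
    · by_contra hn
      push Not at hn
      exact hv ((h v).2 ⟨fun u hu => absurd hu (hiso u), fun u hu hS => hn u hS hu.1⟩)
  · rintro ⟨h1, h2, h3⟩ v
    constructor
    · intro hv
      refine ⟨fun u hu => h1 v u ((posG G σ hσ).symm.symm _ _ hu) hv, fun u hu huS => ?_⟩
      have := (h2 u huS v hv hu.1).2
      rw [hu.2] at this
      cases this
    · rintro ⟨k1, k2⟩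
      by_contra hv
      obtain ⟨u, hu, huv⟩ := h3 v hv (fun u hu => hv (h1 u v hu (k1 u hu)))
      cases hs : σ u v with
      | true => exact hv (h1 u v ⟨huv, hs⟩ hu)
      | false => exact k2 u ⟨huv, hs⟩ hu

/-- `mis(G) ≤ max_σ fix(G_σ) ≤ (3/2)^{m(G)} · mis(G)`, and if `G` has no induced `C₄`
then `max_σ fix(G_σ) = mis(G)`. -/
theorem stmt13 {V : Type*} [Fintype V] (G : SimpleGraph V) (m : ℕ)
    (hm : IsGreatest {n : ℕ | ∃ M : Finset (V × V),
      GoodMatchingM G.Adj M ∧ M.card = n} m) :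
    (∃ σ : V → V → Bool, (∀ u v, σ u v = σ v u) ∧
      misc G.Adj ≤ fixc (posOf G σ) (negOf G σ)) ∧
    (∀ σ : V → V → Bool, (∀ u v, σ u v = σ v u) →
      (fixc (posOf G σ) (negOf G σ) : ℚ) ≤ (3 / 2 : ℚ) ^ m * misc G.Adj) ∧
    ((∀ a b u v, ¬ IsInducedC4 G.Adj a b u v) →
      ∃ σ : V → V → Bool, (∀ u v, σ u v = σ v u) ∧
        fixc (posOf G σ) (negOf G σ) = misc G.Adj ∧
        ∀ σ' : V → V → Bool, (∀ u v, σ' u v = σ' v u) →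
          fixc (posOf G σ') (negOf G σ') ≤ misc G.Adj) := by
  have hub : ∀ σ : V → V → Bool, (∀ u v, σ u v = σ v u) →
      (fixc (posOf G σ) (negOf G σ) : ℚ) ≤ (3 / 2 : ℚ) ^ m * misc G.Adj := by
    intro σ hσ
    have := bound_all G m (fun M hM => hm.2 ⟨M, hM, rfl⟩) _ (posG G σ hσ)
      (fun u v h => h.1) rfl
    rw [fixc, Fx_eq G σ hσ, misc, ← Fx_bot]
    exact this
  have heq : fixc (posOf G fun _ _ => false) (negOf G fun _ _ => false) = misc G.Adj := by
    rw [fixc, Fx_eq G (fun _ _ => false) (fun _ _ => rfl), misc, ← Fx_bot]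
    congr 2
    ext u v
    simp [posG, posOf]
  refine ⟨⟨fun _ _ => false, fun _ _ => rfl, heq.ge⟩, hub, ?_⟩
  intro hno
  refine ⟨fun _ _ => false, fun _ _ => rfl, heq, fun σ hσ => ?_⟩
  have h0 : m = 0 := by
    obtain ⟨M, hM, rfl⟩ := hm.1
    rw [Finset.card_eq_zero, Finset.eq_empty_iff_forall_notMem]
    intro p hp
    obtain ⟨w, x, h, -⟩ := hM.2.2 p hp
    exact hno _ _ _ _ h
  have := hub σ hσ
  rw [h0, pow_zero, one_mul] at this
  exact_mod_cast this
end

section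
/- For every graph G without an induced copy of C₄, every graph H obtained from G by contracting a set of edges satisfies mis(H) ≤ mis(G). -/
/-- maximal independent sets of the subgraph induced on `A` -/
def MisOn {V : Type*} (G : SimpleGraph V) (A : Set V) : Set (Set V) :=
  {S | S ⊆ A ∧ (∀ u ∈ S, ∀ v ∈ S, ¬ G.Adj u v) ∧ ∀ v ∈ A, v ∉ S → ∃ u ∈ S, G.Adj u v}

theorem misOn_extend {V : Type*} [Finite V] (G : SimpleGraph V) (A X : Set V) (hX : X ⊆ A)
    (hi : ∀ u ∈ X, ∀ v ∈ X, ¬ G.Adj u v) : ∃ S ∈ MisOn G A, X ⊆ S := by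
  obtain ⟨S, hXS, hS⟩ := Set.Finite.exists_le_maximal
    (s := {S : Set V | S ⊆ A ∧ ∀ u ∈ S, ∀ v ∈ S, ¬ G.Adj u v}) (Set.toFinite _) (a := X) ⟨hX, hi⟩
  refine ⟨S, ⟨hS.prop.1, hS.prop.2, ?_⟩, hXS⟩
  intro v hv hvS
  by_contra hcon
  push Not at hcon
  have hmem : insert v S ∈ {S : Set V | S ⊆ A ∧ ∀ u ∈ S, ∀ v ∈ S, ¬ G.Adj u v} := by
    refine ⟨Set.insert_subset hv hS.prop.1, ?_⟩
    rintro a (rfl | ha) b (rfl | hb)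
    · exact G.irrefl
    · exact fun h => hcon b hb h.symm
    · exact hcon a ha
    · exact hS.prop.2 a ha b hb
  exact hvS (hS.le_of_ge hmem (Set.subset_insert v S) (Set.mem_insert v S))

/-- A pairwise conflicting family of independent sets is at most as large as `mis`. -/
theorem card_le_misOn {V ι : Type*} [Finite V] (G : SimpleGraph V) (A : Set V)
    (Z : ι → Set V) (hZ : ∀ i, Z i ⊆ A) (hi : ∀ i, ∀ u ∈ Z i, ∀ v ∈ Z i, ¬ G.Adj u v)
    (hc : ∀ i j, i ≠ j → ∃ u ∈ Z i, ∃ v ∈ Z j, G.Adj u v) :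
    Nat.card ι ≤ (MisOn G A).ncard := by
  choose g hg hsub using fun i => misOn_extend G A (Z i) (hZ i) (hi i)
  rw [← Nat.card_coe_set_eq]
  refine Nat.card_le_card_of_injective (fun i => (⟨g i, hg i⟩ : MisOn G A)) ?_
  intro i j hij
  by_contra hne
  obtain ⟨u, hu, v, hv, huv⟩ := hc i j hne
  have he : g i = g j := congrArg Subtype.val hij
  exact (hg j).2.1 u (he ▸ hsub i hu) v (hsub j hv) huv

theorem misOn_conflict {V : Type*} (G : SimpleGraph V) (A S T : Set V)
    (hS : S ∈ MisOn G A) (hT : T ∈ MisOn G A) (hne : S ≠ T) :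
    ∃ u ∈ S, ∃ v ∈ T, G.Adj u v := by
  by_contra hcon
  push Not at hcon
  apply hne
  apply Set.Subset.antisymm
  · intro x hx
    by_contra hxT
    obtain ⟨u, hu, hux⟩ := hT.2.2 x (hS.1 hx) hxT
    exact hcon x hx u hu hux.symm
  · intro x hx
    by_contra hxS
    obtain ⟨u, hu, hux⟩ := hS.2.2 x (hT.1 hx) hxS
    exact hcon u hu x hx hux

theorem misOn_mono {V : Type*} [Finite V] (G : SimpleGraph V) (A B : Set V) (h : A ⊆ B) :
    (MisOn G A).ncard ≤ (MisOn G B).ncard := by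
  rw [← Nat.card_coe_set_eq (MisOn G A)]
  refine card_le_misOn G B (fun i : MisOn G A => i.1) (fun i => i.2.1.trans h)
    (fun i => i.2.2.1) ?_
  intro i j hij
  exact misOn_conflict G A _ _ i.2 j.2 (fun h => hij (Subtype.ext h))

/-- Key inequality for an edge `u v` in a graph without induced 4-cycles. -/
theorem misOn_edge {V : Type*} [Finite V] (G : SimpleGraph V)
    (hC4 : ∀ a b u v, ¬ IsInducedC4 G.Adj a b u v) (A : Set V) (u v : V) (hu : u ∈ A)
    (hv : v ∈ A) (huv : G.Adj u v) :
    (MisOn G (A \ {u, v})).ncard + (MisOn G {x ∈ A | x ≠ u ∧ x ≠ v ∧ ¬ G.Adj u x ∧ ¬ G.Adj v x}).ncard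
      ≤ (MisOn G A).ncard := by
  classical
  set Q : Set V := {x ∈ A | x ≠ u ∧ x ≠ v ∧ ¬ G.Adj u x ∧ ¬ G.Adj v x} with hQ
  -- private-neighbour condition
  let C : V → V → Set V → Prop := fun a b P =>
    ∃ r ∈ A, G.Adj a r ∧ ¬ G.Adj b r ∧ r ≠ a ∧ r ≠ b ∧ ∀ p ∈ P, ¬ G.Adj p r
  let c : Set V → V := fun P => if ¬ C u v P ∧ C v u P then v else u
  let Y : Set V → Set V := fun T => if ∃ t ∈ T, G.Adj v t then T else insert v T
  let Z : (MisOn G (A \ {u, v})) ⊕ (MisOn G Q) → Set V := fun i =>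
    match i with
    | Sum.inl T => Y T.1
    | Sum.inr P => insert (c P.1) P.1
  have hTY : ∀ T, T ⊆ Y T := by
    intro T
    simp only [Y]
    split_ifs
    · exact subset_rfl
    · exact Set.subset_insert _ _
  -- structure of sets compatible with `P ∪ {a}`
  have hA : ∀ a b : V, (a = u ∧ b = v ∨ a = v ∧ b = u) → ∀ T ∈ MisOn G (A \ {u, v}),
      ∀ P ∈ MisOn G Q, (∀ x ∈ T, ∀ y ∈ insert a P, ¬ G.Adj x y) →
      ∀ t ∈ T, t ∉ P → G.Adj b t ∧ ¬ G.Adj a t := by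
    intro a b hab T hT P hP hcomp t ht htP
    have h1 : ¬ G.Adj a t := fun h => hcomp t ht a (Set.mem_insert _ _) h.symm
    refine ⟨?_, h1⟩
    by_contra h2
    have htA := hT.1 ht
    have htQ : t ∈ Q := by
      refine ⟨htA.1, fun h => htA.2 (by simp [h]), fun h => htA.2 (by simp [h]), ?_⟩
      rcases hab with ⟨rfl, rfl⟩ | ⟨rfl, rfl⟩
      · exact ⟨h1, h2⟩
      · exact ⟨h2, h1⟩
    obtain ⟨p, hp, hpt⟩ := hP.2.2 t htQ htP
    exact hcomp t ht p (Set.mem_insert_of_mem _ hp) hpt.symm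
  have hB : ∀ a b : V, (a = u ∧ b = v ∨ a = v ∧ b = u) → ∀ T ∈ MisOn G (A \ {u, v}),
      ∀ P ∈ MisOn G Q, C a b P → ∃ x ∈ T, ∃ y ∈ insert a P, G.Adj x y := by
    intro a b hab T hT P hP hC
    by_contra hcon
    push Not at hcon
    have hs := hA a b hab T hT P hP hcon
    obtain ⟨r, hrA, har, hbr, hra, hrb, hrP⟩ := hC
    have hrT : r ∉ T := fun h => hcon r h a (Set.mem_insert _ _) har.symm
    have hr' : r ∈ A \ {u, v} := by
      refine ⟨hrA, ?_⟩
      rcases hab with ⟨rfl, rfl⟩ | ⟨rfl, rfl⟩ <;> simp [hra, hrb]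
    obtain ⟨t, ht, htr⟩ := hT.2.2 r hr' hrT
    have htP : t ∉ P := fun h => hrP t h htr
    obtain ⟨hbt, hat⟩ := hs t ht htP
    have hab' : G.Adj a b := by
      rcases hab with ⟨rfl, rfl⟩ | ⟨rfl, rfl⟩
      · exact huv
      · exact huv.symm
    have hta : a ≠ t := by
      rintro rfl
      have := (hT.1 ht).2
      rcases hab with ⟨rfl, rfl⟩ | ⟨rfl, rfl⟩ <;> simp at this
    exact hC4 a r t b ⟨hra.symm, hta, hab'.ne, htr.ne.symm, hrb, hbt.ne.symm,
      har, htr.symm, hbt.symm, hab'.symm, hat, fun h => hbr h.symm⟩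
  have hTP : ∀ T ∈ MisOn G (A \ {u, v}), ∀ P ∈ MisOn G Q,
      ∃ x ∈ Y T, ∃ y ∈ insert (c P) P, G.Adj x y := by
    intro T hT P hP
    by_cases h : ¬ C u v P ∧ C v u P
    · have hc : c P = v := if_pos h
      rw [hc]
      obtain ⟨x, hx, y, hy, hxy⟩ := hB v u (Or.inr ⟨rfl, rfl⟩) T hT P hP h.2
      exact ⟨x, hTY T hx, y, hy, hxy⟩
    · have hc : c P = u := if_neg h
      rw [hc]
      by_cases h1 : C u v P
      · obtain ⟨x, hx, y, hy, hxy⟩ := hB u v (Or.inl ⟨rfl, rfl⟩) T hT P hP h1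
        exact ⟨x, hTY T hx, y, hy, hxy⟩
      · have h2 : ¬ C v u P := fun h2 => h ⟨h1, h2⟩
        by_contra hcon
        push Not at hcon
        have hs := hA u v (Or.inl ⟨rfl, rfl⟩) T hT P hP (fun x hx => hcon x (hTY T hx))
        have hvT : ¬ ∃ t ∈ T, G.Adj v t := by
          rintro ⟨t, ht, hvt⟩
          have htA := hT.1 ht
          by_cases htP : t ∈ P
          · exact (hP.1 htP).2.2.2.2 hvt
          · refine h2 ⟨t, htA.1, hvt, (hs t ht htP).2, fun h => htA.2 (by simp [h]),
              fun h => htA.2 (by simp [h]), fun p hp hpt => ?_⟩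
            exact hcon t (hTY T ht) p (Set.mem_insert_of_mem _ hp) hpt.symm
        have hY : Y T = insert v T := if_neg hvT
        exact hcon v (hY ▸ Set.mem_insert _ _) u (Set.mem_insert _ _) huv.symm
  have hcP : ∀ P, c P = u ∨ c P = v := by
    intro P
    simp only [c]
    split_ifs
    · exact Or.inr rfl
    · exact Or.inl rfl
  have key := card_le_misOn G A Z ?_ ?_ ?_
  · rwa [Nat.card_sum, Nat.card_coe_set_eq, Nat.card_coe_set_eq] at key
  · rintro (T | P)
    · simp only [Z, Y]
      have := T.2.1.trans Set.sdiff_subset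
      split_ifs
      · exact this
      · exact Set.insert_subset hv this
    · refine Set.insert_subset ?_ (P.2.1.trans (fun x hx => hx.1))
      rcases hcP P.1 with h | h <;> rw [h] <;> assumption
  · rintro (T | P)
    · simp only [Z, Y]
      split_ifs with h
      · exact T.2.2.1
      · push Not at h
        rintro a (rfl | ha) b (rfl | hb)
        · exact G.irrefl
        · exact h b hb
        · exact fun h' => h a ha h'.symm
        · exact T.2.2.1 a ha b hb
    · have hno : ∀ p ∈ P.1, ¬ G.Adj (c P.1) p := by
        intro p hp
        have := P.2.1 hp
        rcases hcP P.1 with h | h <;> rw [h]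
        · exact this.2.2.2.1
        · exact this.2.2.2.2
      rintro a (rfl | ha) b (rfl | hb)
      · exact G.irrefl
      · exact hno b hb
      · exact fun h' => hno a ha h'.symm
      · exact P.2.2.1 a ha b hb
  · rintro (T | P) (T' | P') hne
    · obtain ⟨x, hx, y, hy, hxy⟩ := misOn_conflict G _ _ _ T.2 T'.2
        (fun h => hne (congrArg Sum.inl (Subtype.ext h)))
      exact ⟨x, hTY _ hx, y, hTY _ hy, hxy⟩
    · exact hTP _ T.2 _ P'.2
    · obtain ⟨x, hx, y, hy, hxy⟩ := hTP _ T'.2 _ P.2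
      exact ⟨y, hy, x, hx, hxy.symm⟩
    · obtain ⟨x, hx, y, hy, hxy⟩ := misOn_conflict G _ _ _ P.2 P'.2
        (fun h => hne (congrArg Sum.inr (Subtype.ext h)))
      exact ⟨x, Set.mem_insert_of_mem _ hx, y, Set.mem_insert_of_mem _ hy, hxy⟩

theorem misOn_le_vertex {W : Type*} [Finite W] (H : SimpleGraph W) (B : Set W) (w : W) :
    (MisOn H B).ncard ≤ (MisOn H (B \ {w})).ncard
      + (MisOn H {x ∈ B | x ≠ w ∧ ¬ H.Adj w x}).ncard := by
  have hsub : MisOn H B ⊆ MisOn H (B \ {w}) ∪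
      (fun S => insert w S) '' MisOn H {x ∈ B | x ≠ w ∧ ¬ H.Adj w x} := by
    intro S hS
    by_cases hw : w ∈ S
    · right
      refine ⟨S \ {w}, ⟨?_, ?_, ?_⟩, by simp [hw]⟩
      · intro x hx
        exact ⟨hS.1 hx.1, hx.2, hS.2.1 w hw x hx.1⟩
      · exact fun a ha b hb => hS.2.1 a ha.1 b hb.1
      · intro x hx hxS
        obtain ⟨y, hy, hyx⟩ := hS.2.2 x hx.1 (fun h => hxS ⟨h, hx.2.1⟩)
        refine ⟨y, ⟨hy, ?_⟩, hyx⟩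
        rintro rfl
        exact hx.2.2 hyx
    · left
      exact ⟨fun x hx => ⟨hS.1 hx, fun h => hw (h ▸ hx)⟩, hS.2.1, fun x hx => hS.2.2 x hx.1⟩
  calc _ ≤ _ := Set.ncard_le_ncard hsub (Set.toFinite _)
    _ ≤ _ := Set.ncard_union_le _ _
    _ ≤ _ := Nat.add_le_add_left (Set.ncard_image_le (Set.toFinite _)) _

theorem main_ind {V W : Type*} [Finite V] [Finite W]
    (G : SimpleGraph V) (H : SimpleGraph W)
    (hC4 : ∀ a b u v, ¬ IsInducedC4 G.Adj a b u v)
    (f : V → W) (hf : Function.Surjective f)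
    (hfib : ∀ w : W, ∀ u v : V, f u = w → f v = w →
      Relation.ReflTransGen (fun a b => f a = w ∧ f b = w ∧ G.Adj a b) u v)
    (hH : ∀ x y : W, H.Adj x y ↔ x ≠ y ∧ ∃ u v : V, f u = x ∧ f v = y ∧ G.Adj u v) :
    ∀ (n : ℕ) (B : Set W), B.ncard ≤ n → (MisOn H B).ncard ≤ (MisOn G (f ⁻¹' B)).ncard := by
  intro n
  induction n with
  | zero =>
    intro B hB
    have hB0 : B = ∅ := by
      rw [← Set.ncard_eq_zero (Set.toFinite B)]; omega
    subst hB0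
    refine Set.ncard_le_ncard_of_injOn (fun _ => ∅) ?_ ?_ (Set.toFinite _)
    · intro S hS
      exact ⟨by simp, by simp, by simp⟩
    · intro S hS T hT _
      rw [Set.subset_empty_iff.1 hS.1, Set.subset_empty_iff.1 hT.1]
  | succ n ih =>
    intro B hB
    by_cases hedge : ∃ u v, f u ∈ B ∧ f u = f v ∧ G.Adj u v
    · obtain ⟨u, v, hu, huv, hadj⟩ := hedge
      have hlt : ∀ B' ⊆ B, f u ∉ B' → B'.ncard ≤ n := by
        intro B' h1 h2
        have : B'.ncard < B.ncard :=
          Set.ncard_lt_ncard (Set.ssubset_iff_subset_ne.2 ⟨h1, fun h => h2 (h ▸ hu)⟩)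
            (Set.toFinite _)
        omega
      have h1 := misOn_le_vertex H B (f u)
      have h2 := ih (B \ {f u}) (hlt _ Set.sdiff_subset (by simp))
      have h3 := ih {x ∈ B | x ≠ f u ∧ ¬ H.Adj (f u) x}
        (hlt _ (fun x hx => hx.1) (fun h => h.2.1 rfl))
      have h4 := misOn_edge G hC4 (f ⁻¹' B) u v hu (by simpa [← huv] using hu) hadj
      have h5 := misOn_mono G (f ⁻¹' (B \ {f u})) (f ⁻¹' B \ {u, v}) (by
        intro x hx
        refine ⟨hx.1, ?_⟩
        rintro (rfl | rfl)
        · exact hx.2 rfl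
        · exact hx.2 huv.symm)
      have h6 := misOn_mono G (f ⁻¹' {x ∈ B | x ≠ f u ∧ ¬ H.Adj (f u) x})
        {x ∈ f ⁻¹' B | x ≠ u ∧ x ≠ v ∧ ¬ G.Adj u x ∧ ¬ G.Adj v x} (by
        intro x hx
        obtain ⟨hxB, hxu, hxa⟩ := hx
        refine ⟨hxB, ?_, ?_, ?_, ?_⟩
        · rintro rfl
          exact hxu rfl
        · rintro rfl
          exact hxu huv.symm
        · intro h
          exact hxa ((hH _ _).2 ⟨hxu.symm, u, x, rfl, rfl, h⟩)
        · intro h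
          exact hxa ((hH _ _).2 ⟨hxu.symm, v, x, huv.symm, rfl, h⟩))
      omega
    · have hinj : ∀ x y, f x ∈ B → f x = f y → x = y := by
        intro x y hx hxy
        rcases Relation.ReflTransGen.cases_head (hfib (f x) x y rfl hxy.symm) with h | ⟨z, hz, _⟩
        · exact h
        · exact absurd ⟨x, z, hx, hz.2.1.symm, hz.2.2⟩ hedge
      refine Set.ncard_le_ncard_of_injOn (fun S => f ⁻¹' S) ?_
        (fun S _ T _ h => Set.preimage_injective.2 hf h) (Set.toFinite _)
      intro S hS
      refine ⟨Set.preimage_mono hS.1, ?_, ?_⟩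
      · intro a ha b hb hab
        by_cases he : f a = f b
        · exact hedge ⟨a, b, hS.1 ha, he, hab⟩
        · exact hS.2.1 _ ha _ hb ((hH _ _).2 ⟨he, a, b, rfl, rfl, hab⟩)
      · intro x hx hxS
        obtain ⟨y, hy, hyx⟩ := hS.2.2 (f x) hx hxS
        obtain ⟨_, a, b, ha, hb, hab⟩ := (hH _ _).1 hyx
        have : x = b := hinj x b hx hb.symm
        subst this
        exact ⟨a, by simpa [ha] using hy, hab⟩

theorem misc_eq {V : Type*} (G : SimpleGraph V) : misc G.Adj = (MisOn G Set.univ).ncard := by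
  unfold misc MisOn IsMaxIndep
  simp

/-- If `G` has no induced `C₄` and `H` is obtained from `G` by contracting a set of
edges (`H` is the quotient of `G` along a surjection `f` with connected fibers),
then `mis(H) ≤ mis(G)`. -/
theorem stmt16 {V W : Type*} [Fintype V] [Fintype W]
    (G : SimpleGraph V) (H : SimpleGraph W)
    (hC4 : ∀ a b u v, ¬ IsInducedC4 G.Adj a b u v)
    (f : V → W) (hf : Function.Surjective f)
    (hfib : ∀ w : W, ∀ u v : V, f u = w → f v = w →
      Relation.ReflTransGen (fun a b => f a = w ∧ f b = w ∧ G.Adj a b) u v)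
    (hH : ∀ x y : W, H.Adj x y ↔ x ≠ y ∧ ∃ u v : V, f u = x ∧ f v = y ∧ G.Adj u v) :
    misc H.Adj ≤ misc G.Adj := by
  rw [misc_eq, misc_eq]
  have := main_ind G H hC4 f hf hfib hH _ Set.univ le_rfl
  rwa [Set.preimage_univ] at this
end
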